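/- Let d ≥ 2 be an integer, c ∈ ℚ, and φ(z) = z^d + c. Let s be the number of Type II primes of φ, let m = 2 if d = 2 and m = 1 otherwise, and let N = (2/d^m)·((d^m + 1)^{s+2} − 1) (this is a natural number). Then for every α ∈ ℚ, either there exist natural numbers i < j < N with φ^[i](α) = φ^[j](α), or for every real number L such that h(φ^[k](α))/d^k tends to L as k → ∞ one has L ≥ (1/d^{N+2}) · (h(c) − d(d + 2m)·log 2). -/

import Mathlib

open Filter

/-- The absolute logarithmic height of a rational number. -/
noncomputable def ratHeight (q : ℚ) : ℝ := Real.log (max (|q.num| : ℝ) (q.den : ℝ))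

lemma dyn_growth (d : ℕ) (hd : 2 ≤ d) (φ : ℚ → ℚ) (f : ℚ → ℝ) (κ T : ℝ) (hκ : 1 ≤ κ) (hT : 1 ≤ T)
    (hstep : ∀ x, κ * T < f x → (f x / κ) ^ d ≤ f (φ x) / κ) (x : ℚ) (hx : κ * T < f x) (n : ℕ) :
    κ * T < f (φ^[n] x) ∧ (f x / κ) ^ (d ^ n) ≤ f (φ^[n] x) / κ := by
  have hκ0 : 0 < κ := by linarith
  have hone : ∀ y, κ * T < f y → T < f y / κ := by
    intro y hy
    rw [lt_div_iff₀ hκ0]; linarith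
  induction n with
  | zero => simpa using hx
  | succ n ih =>
    obtain ⟨h1, h2⟩ := ih
    rw [Function.iterate_succ_apply']
    have h3 := hstep _ h1
    have h4 := hone _ h1
    have h5 : f (φ^[n] x) / κ ≤ (f (φ^[n] x) / κ) ^ d :=
      le_self_pow₀ (by linarith) (by omega)
    have h6 : T < f (φ (φ^[n] x)) / κ := by linarith
    refine ⟨?_, ?_⟩
    · rw [lt_div_iff₀ hκ0] at h6; linarith
    · rw [pow_succ, pow_mul]
      refine le_trans (pow_le_pow_left₀ ?_ h2 d) h3
      have := hone _ hx
      have h7 : 0 ≤ f x / κ := by linarith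
      positivity

lemma dyn_escaped (d : ℕ) (hd : 2 ≤ d) (φ : ℚ → ℚ) (f : ℚ → ℝ) (κ T : ℝ) (hκ : 1 ≤ κ) (hT : 1 ≤ T)
    (hstep : ∀ x, κ * T < f x → (f x / κ) ^ d ≤ f (φ x) / κ)
    (hsub : ∀ x y, f (x - y) ≤ κ * max (f x) (f y))
    (hpos : ∀ x y, x ≠ y → 0 < f (x - y))
    (x y : ℚ) (l m n : ℕ) (hmn : m ≤ n) (hy : y = φ^[l] x) (hne : x ≠ y)
    (hesc : κ * T < f (φ^[m] y)) :
    Real.log (f (x - y)) + Real.log T ≤ 2 * Real.log κ +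
      2 * (d : ℝ) ^ m / (d : ℝ) ^ n * Real.log (max 1 (f (φ^[n] y))) := by
  have hκ0 : 0 < κ := by linarith
  have hd0 : (1 : ℝ) ≤ d := by exact_mod_cast (by omega : 1 ≤ d)
  have hT0 : 0 < T := by linarith
  set X := f (φ^[n] y) with hX
  set g := Real.log (max 1 X) / (d : ℝ) ^ n with hg
  have hdn : (0 : ℝ) < (d : ℝ) ^ n := by positivity
  have hlX : 0 ≤ Real.log (max 1 X) := Real.log_nonneg (le_max_left _ _)
  have hg0 : 0 ≤ g := by positivity
  have hXd : X / κ ≤ max 1 X := by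
    rw [div_le_iff₀ hκ0]
    have := le_max_left 1 X
    have := le_max_right 1 X
    nlinarith
  -- basic consequence
  have key : ∀ (z : ℝ) (r : ℕ), 0 < z → z ^ r ≤ X / κ → (r : ℝ) * Real.log z ≤ Real.log (max 1 X) := by
    intro z r hz h
    rw [← Real.log_pow]
    exact Real.log_le_log (by positivity) (h.trans hXd)
  have hTm : Real.log T ≤ (d : ℝ) ^ m * g := by
    have h1 := (dyn_growth d hd φ f κ T hκ hT hstep _ hesc (n - m)).2
    rw [← Function.iterate_add_apply, Nat.sub_add_cancel hmn] at h1
    have h2 : T ≤ f (φ^[m] y) / κ := by rw [le_div_iff₀ hκ0]; linarith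
    have h3 := key T _ hT0 ((pow_le_pow_left₀ hT0.le h2 _).trans h1)
    have h4 : (d : ℝ) ^ n = (d : ℝ) ^ (n - m) * (d : ℝ) ^ m := by
      rw [← pow_add, Nat.sub_add_cancel hmn]
    have h5 : (d : ℝ) ^ m * g = Real.log (max 1 X) / (d : ℝ) ^ (n - m) := by
      rw [hg, h4]; field_simp
    rw [h5, le_div_iff₀ (by positivity)]
    push_cast at h3
    linarith
  have hb : ∀ z : ℚ, ∀ r : ℕ, φ^[r] z = y → f z ≤ κ * max T (Real.exp g) := by
    intro z r hr
    by_cases hz : κ * T < f z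
    · have h1 := (dyn_growth d hd φ f κ T hκ hT hstep _ hz (n + r)).2
      rw [Function.iterate_add_apply, hr] at h1
      have hz1 : T < f z / κ := by rw [lt_div_iff₀ hκ0]; linarith
      have h2 : (f z / κ) ^ (d ^ n) ≤ X / κ :=
        (pow_le_pow_right₀ (by linarith) (Nat.pow_le_pow_right (by omega) (by omega))).trans h1
      have h3 := key _ _ (by linarith) h2
      have h4 : Real.log (f z / κ) ≤ g := by
        rw [hg, le_div_iff₀ hdn]; push_cast at h3; linarith
      have h5 : f z / κ ≤ Real.exp g := (Real.log_le_iff_le_exp (by linarith)).1 h4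
      rw [div_le_iff₀ hκ0] at h5
      calc f z ≤ κ * Real.exp g := by linarith
        _ ≤ _ := by gcongr; exact le_max_right _ _
    · calc f z ≤ κ * T := not_lt.1 hz
        _ ≤ _ := by gcongr; exact le_max_left _ _
  have h1 : f (x - y) ≤ κ * (κ * max T (Real.exp g)) :=
    (hsub x y).trans (by
      gcongr
      exact max_le (hb x l hy.symm) (hb y 0 rfl))
  have h2 : Real.log (f (x - y)) ≤ 2 * Real.log κ + max (Real.log T) g := by
    have hm : 0 < max T (Real.exp g) := lt_max_of_lt_left hT0
    refine (Real.log_le_log (hpos x y hne) h1).trans ?_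
    rw [Real.log_mul hκ0.ne' (by positivity), Real.log_mul hκ0.ne' hm.ne']
    have : Real.log (max T (Real.exp g)) ≤ max (Real.log T) g := by
      rcases le_total T (Real.exp g) with h | h
      · rw [max_eq_right h, Real.log_exp]; exact le_max_right _ _
      · rw [max_eq_left h]; exact le_max_left _ _
    linarith
  have h3 : g ≤ (d : ℝ) ^ m * g := le_mul_of_one_le_left hg0 (one_le_pow₀ hd0)
  have h4 : 2 * (d : ℝ) ^ m / (d : ℝ) ^ n * Real.log (max 1 X) = 2 * ((d : ℝ) ^ m * g) := by
    rw [hg]; ring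
  rw [h4]
  have h5 : max (Real.log T) g ≤ (d : ℝ) ^ m * g := max_le hTm h3
  linarith

/-- nonescaped -/
lemma dyn_noesc (d : ℕ) (hd : 2 ≤ d) (φ : ℚ → ℚ) (f : ℚ → ℝ) (κ T : ℝ) (hκ : 1 ≤ κ) (hT : 1 ≤ T)
    (hstep : ∀ x, κ * T < f x → (f x / κ) ^ d ≤ f (φ x) / κ) (x y : ℚ) (l m : ℕ)
    (hy : y = φ^[l] x) (hesc : ¬ κ * T < f (φ^[m] y)) :
    ∀ t ≤ m, f (φ^[t] x) ≤ κ * T ∧ f (φ^[t] y) ≤ κ * T := by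
  intro t ht
  constructor
  · by_contra h
    have := (dyn_growth d hd φ f κ T hκ hT hstep _ (not_le.1 h) (l + (m - t))).1
    rw [← Function.iterate_add_apply, show l + (m - t) + t = m + l by omega,
      Function.iterate_add_apply, ← hy] at this
    exact hesc this
  · by_contra h
    have := (dyn_growth d hd φ f κ T hκ hT hstep _ (not_le.1 h) (m - t)).1
    rw [← Function.iterate_add_apply, show (m - t) + t = m by omega] at this
    exact hesc this
lemma arch_step (d : ℕ) (hd : 2 ≤ d) (c : ℝ) (T : ℝ) (hT : 1 ≤ T) (hTd : T ^ d = max 1 |c|)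
    (x : ℝ) (hx : 2 * T < |x|) : (|x| / 2) ^ d ≤ |x ^ d + c| / 2 := by
  have h1 : |x| ^ d - |c| ≤ |x ^ d + c| := by
    have := abs_sub_abs_le_abs_sub (x ^ d) (-c)
    rw [abs_neg, abs_pow, sub_neg_eq_add] at this
    exact this
  have h2 : |c| ≤ T ^ d := by rw [hTd]; exact le_max_right _ _
  have h3 : T ^ d ≤ (|x| / 2) ^ d := pow_le_pow_left₀ (by linarith) (by linarith) d
  have h4 : |x| ^ d = 2 ^ d * (|x| / 2) ^ d := by rw [← mul_pow]; congr 1; ring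
  have h5 : (4 : ℝ) ≤ 2 ^ d := by
    calc (4 : ℝ) = 2 ^ 2 := by norm_num
      _ ≤ 2 ^ d := pow_le_pow_right₀ (by norm_num) hd
  have h6 : 0 ≤ (|x| / 2) ^ d := by positivity
  nlinarith

lemma pow_diff_pos (d : ℕ) (hd : 2 ≤ d) (T a b : ℝ) (hT : 1 ≤ T) (ha : 0 ≤ a) (hb : 0 ≤ b)
    (ha' : T ^ d / 2 ≤ a ^ d) (hb' : T ^ d / 2 ≤ b ^ d) :
    |a - b| * T ^ (d - 1) ≤ |a ^ d - b ^ d| := by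
  obtain ⟨e, rfl⟩ : ∃ e, d = e + 2 := ⟨d - 2, by omega⟩
  have hh : ∀ z : ℝ, 0 ≤ z → T ^ (e + 2) / 2 ≤ z ^ (e + 2) → T ^ (e + 1) / 2 ≤ z ^ (e + 1) := by
    intro z hz h
    have hTp : 0 < T ^ (e + 1) := by positivity
    rcases le_total T z with h' | h'
    · have := pow_le_pow_left₀ (by linarith) h' (e + 1)
      linarith
    · have h1 : z ^ (e + 2) ≤ z ^ (e + 1) * T := by
        rw [pow_succ z (e + 1)]; gcongr
      have h2 : T ^ (e + 2) = T ^ (e + 1) * T := pow_succ _ _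
      by_contra hc
      nlinarith
  rw [show e + 2 - 1 = e + 1 by omega]
  wlog hab : b ≤ a generalizing a b
  · rw [abs_sub_comm a b, abs_sub_comm (a ^ _)]
    exact this b a hb ha hb' ha' (by linarith)
  have h1 := hh a ha ha'
  have h2 := hh b hb hb'
  rw [abs_of_nonneg (by linarith), abs_of_nonneg (sub_nonneg.2 (pow_le_pow_left₀ hb hab _))]
  have h3 : b ^ e ≤ a ^ e := pow_le_pow_left₀ hb hab e
  have h4 : 0 ≤ a * b * (a ^ e - b ^ e) := by
    have : 0 ≤ a ^ e - b ^ e := by linarith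
    positivity
  have h5 : (a - b) * T ^ (e + 1) ≤ (a - b) * (a ^ (e + 1) + b ^ (e + 1)) := by
    apply mul_le_mul_of_nonneg_left _ (by linarith)
    linarith
  have h6 : (a - b) * (a ^ (e + 1) + b ^ (e + 1)) =
    a ^ (e + 2) - b ^ (e + 2) - a * b * (a ^ e - b ^ e) := by ring
  linarith

lemma arch_deriv (d : ℕ) (hd : 2 ≤ d) (c : ℝ) (T : ℝ) (hT : 1 ≤ T) (hTd : T ^ d = max 1 |c|)
    (hbig : 4 ≤ T ^ (d - 1)) (x y : ℝ) (hs : (0 ≤ x) ↔ (0 ≤ y))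
    (hx : |x ^ d + c| ≤ 2 * T) (hy : |y ^ d + c| ≤ 2 * T) :
    |x - y| * T ^ (d - 1) ≤ |(x ^ d + c) - (y ^ d + c)| := by
  have hTT : T ^ d = T ^ (d - 1) * T := by rw [← pow_succ]; congr 1; omega
  have hc : |c| = T ^ d := by
    rw [hTd]
    symm
    apply max_eq_right
    by_contra h
    rw [max_eq_left (by linarith)] at hTd
    nlinarith
  have hlow : ∀ z : ℝ, |z ^ d + c| ≤ 2 * T → T ^ d / 2 ≤ |z| ^ d := by
    intro z hz
    have h1 : |c| - |z| ^ d ≤ |z ^ d + c| := by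
      have := abs_sub_abs_le_abs_sub c (-(z ^ d))
      rw [abs_neg, abs_pow, sub_neg_eq_add, add_comm c] at this
      exact this
    nlinarith
  have h := pow_diff_pos d hd T |x| |y| hT (abs_nonneg _) (abs_nonneg _) (hlow x hx) (hlow y hy)
  rw [show (x ^ d + c) - (y ^ d + c) = x ^ d - y ^ d by ring]
  by_cases h0 : 0 ≤ x
  · have h1 := hs.1 h0
    rwa [abs_of_nonneg h0, abs_of_nonneg h1] at h
  · have h1 : ¬ 0 ≤ y := fun h => h0 (hs.2 h)
    rw [abs_of_neg (not_le.1 h0), abs_of_neg (not_le.1 h1), neg_pow, neg_pow y, ← mul_sub, abs_mul,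
      abs_pow, abs_neg, abs_one, one_pow, one_mul, show -x - -y = -(x - y) by ring, abs_neg] at h
    exact h

lemma arch_local (d : ℕ) (hd : 2 ≤ d) (c : ℚ) (m : ℕ) (hm : m = if d = 2 then 2 else 1)
    (T : ℝ) (hT : 1 ≤ T) (hTd : T ^ d = max 1 |(c : ℝ)|) :
    ∃ cl : ℚ → Fin 4, ∀ (x y : ℚ) (l n : ℕ), m ≤ n → y = (fun z : ℚ => z ^ d + c)^[l] x → x ≠ y →
      cl x = cl y →
      Real.log |((x - y : ℚ) : ℝ)| + Real.log T ≤ 2 * m * Real.log 2 +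
        2 * (d : ℝ) ^ m / (d : ℝ) ^ n *
          Real.log (max 1 |(((fun z : ℚ => z ^ d + c)^[n] y : ℚ) : ℝ)|) := by
  set φ : ℚ → ℚ := fun z : ℚ => z ^ d + c with hφ
  have hm1 : (1 : ℝ) ≤ m := by
    have : 1 ≤ m := by rw [hm]; split_ifs <;> norm_num
    exact_mod_cast this
  have hl2 : 0 < Real.log 2 := Real.log_pos (by norm_num)
  have hφ' : ∀ z : ℚ, ((φ z : ℚ) : ℝ) = (z : ℝ) ^ d + c := by intro z; simp [hφ]
  set f : ℚ → ℝ := fun z => |(z : ℝ)| with hf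
  have hstep : ∀ x, 2 * T < f x → (f x / 2) ^ d ≤ f (φ x) / 2 := by
    intro x hx
    simp only [hf, hφ']
    exact arch_step d hd c T hT hTd x hx
  have hsub : ∀ x y, f (x - y) ≤ 2 * max (f x) (f y) := by
    intro x y
    simp only [hf]
    push_cast
    have := abs_sub (x : ℝ) y
    have := le_max_left |(x : ℝ)| |(y : ℝ)|
    have := le_max_right |(x : ℝ)| |(y : ℝ)|
    linarith
  have hpos : ∀ x y, x ≠ y → 0 < f (x - y) := by
    intro x y hxy
    simp only [hf]
    rw [abs_pos]
    exact_mod_cast sub_ne_zero.2 hxy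
  -- reduction to the nonescaped case
  suffices H : ∃ cl : ℚ → Fin 4, ∀ x y : ℚ, (∀ t ≤ m, f (φ^[t] x) ≤ 2 * T ∧ f (φ^[t] y) ≤ 2 * T) →
      cl x = cl y → f (x - y) * T ≤ 4 ^ m by
    obtain ⟨cl, hcl⟩ := H
    refine ⟨cl, fun x y l n hmn hy hne hxy => ?_⟩
    by_cases hesc : 2 * T < f (φ^[m] y)
    · have := dyn_escaped d hd φ f 2 T (by norm_num) hT hstep hsub hpos x y l m n hmn hy hne hesc
      simp only [hf] at this
      refine this.trans ?_
      gcongr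
      nlinarith
    · have h1 := dyn_noesc d hd φ f 2 T (by norm_num) hT hstep x y l m hy hesc
      have h2 := hcl x y h1 hxy
      have h3 := hpos x y hne
      have h4 : Real.log (f (x - y)) + Real.log T ≤ 2 * m * Real.log 2 := by
        rw [← Real.log_mul h3.ne' (by positivity)]
        refine (Real.log_le_log (by positivity) h2).trans ?_
        rw [Real.log_pow, show (4 : ℝ) = 2 ^ 2 by norm_num, Real.log_pow]
        push_cast
        linarith
      have h5 : 0 ≤ 2 * (d : ℝ) ^ m / (d : ℝ) ^ n *
          Real.log (max 1 |((φ^[n] y : ℚ) : ℝ)|) :=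
        mul_nonneg (by positivity) (Real.log_nonneg (le_max_left _ _))
      simp only [hf] at h4
      linarith
  by_cases hbig : 4 ≤ T ^ (d - 1)
  · have hder : ∀ x y : ℚ, ((0 ≤ x) ↔ (0 ≤ y)) → f (φ x) ≤ 2 * T → f (φ y) ≤ 2 * T →
        f (x - y) * T ^ (d - 1) ≤ f (φ x - φ y) := by
      intro x y hs hx hy
      simp only [hf, hφ', Rat.cast_sub] at hx hy ⊢
      exact arch_deriv d hd c T hT hTd hbig x y (by exact_mod_cast hs) hx hy
    have hdiff : ∀ x y : ℚ, f x ≤ 2 * T → f y ≤ 2 * T → f (x - y) ≤ 4 * T := by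
      intro x y hx hy
      have := hsub x y
      have := max_le hx hy
      linarith
    refine ⟨fun z => if 0 ≤ z then (if 0 ≤ φ z then 0 else 1) else (if 0 ≤ φ z then 2 else 3), ?_⟩
    intro x y hes hcl
    have hs1 : (0 ≤ x) ↔ (0 ≤ y) := by
      simp only at hcl
      split_ifs at hcl <;> first | tauto | (exfalso; revert hcl; decide)
    have hs2 : (0 ≤ φ x) ↔ (0 ≤ φ y) := by
      simp only at hcl
      split_ifs at hcl <;> first | tauto | (exfalso; revert hcl; decide)
    by_cases hd2 : d = 2
    · have hm2 : m = 2 := by rw [hm, if_pos hd2]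
      have e1 := hes 1 (by omega)
      have e2 := hes 2 (by omega)
      simp only [Function.iterate_succ, Function.iterate_zero, Function.comp, id] at e1 e2
      have h1 := hder x y hs1 e1.1 e1.2
      have h2 := hder (φ x) (φ y) hs2 e2.1 e2.2
      have h3 := hdiff _ _ e2.1 e2.2
      rw [show d - 1 = 1 by omega, pow_one] at h1 h2
      rw [hm2]
      have h4 : f (φ x - φ y) ≤ 4 := by
        have : f (φ x - φ y) * T ≤ 4 * T := by linarith
        exact le_of_mul_le_mul_right this (by linarith)
      norm_num
      linarith
    · have hm2 : m = 1 := by rw [hm, if_neg hd2]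
      have e1 := hes 1 (by omega)
      simp only [Function.iterate_succ, Function.iterate_zero, Function.comp, id] at e1
      have h1 := hder x y hs1 e1.1 e1.2
      have h3 := hdiff _ _ e1.1 e1.2
      rw [hm2, pow_one]
      have h0 : 0 ≤ f (x - y) := abs_nonneg _
      have h4 : T * T ≤ T ^ (d - 1) := by
        rw [← sq]; exact pow_le_pow_right₀ hT (by omega)
      have h5 : (f (x - y) * T) * T ≤ 4 * T := by
        calc _ = f (x - y) * (T * T) := by ring
          _ ≤ f (x - y) * T ^ (d - 1) := by gcongr
          _ ≤ _ := by linarith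
      exact le_of_mul_le_mul_right h5 (by linarith)
  · push Not at hbig
    refine ⟨fun z => if (z : ℝ) < -T then 0 else if (z : ℝ) < 0 then 1 else if (z : ℝ) < T then 2 else 3, ?_⟩
    intro x y hes hcl
    have e0 := hes 0 (by omega)
    simp only [Function.iterate_zero, id, hf, abs_le] at e0
    have h1 : f (x - y) ≤ T := by
      simp only [hf, Rat.cast_sub, abs_le]
      simp only at hcl
      split_ifs at hcl <;> first | (constructor <;> linarith) | (exfalso; revert hcl; decide)
    have h2 : T * T ≤ 4 ^ m := by
      by_cases hd2 : d = 2
      · have hm2 : m = 2 := by rw [hm, if_pos hd2]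
        rw [hm2]
        rw [show d - 1 = 1 by omega, pow_one] at hbig
        nlinarith
      · have hm2 : m = 1 := by rw [hm, if_neg hd2]
        have h4 : T * T ≤ T ^ (d - 1) := by
          rw [← sq]; exact pow_le_pow_right₀ hT (by omega)
        rw [hm2]; linarith
    calc f (x - y) * T ≤ T * T := by gcongr
      _ ≤ _ := h2
lemma padic_deriv0 (p : ℕ) [hp : Fact p.Prime] (d : ℕ) (t : ℚ_[p]) (ht : 3 * ‖t‖ ≤ 1) :
    ‖(d : ℚ_[p])‖ * ‖t‖ ≤ ‖(1 + t) ^ d - 1‖ := by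
  rcases Nat.eq_zero_or_pos d with rfl | hd
  · simp
  by_cases ht0 : t = 0
  · simp [ht0]
  obtain ⟨e, rfl⟩ : ∃ e, d = e + 1 := ⟨d - 1, by omega⟩
  have htp : 0 < ‖t‖ := norm_pos_iff.2 ht0
  have hd0 : ((e + 1 : ℕ) : ℚ_[p]) ≠ 0 := Nat.cast_ne_zero.2 (by omega)
  have hdp : 0 < ‖((e + 1 : ℕ) : ℚ_[p])‖ := norm_pos_iff.2 hd0
  have hnat : ∀ n : ℕ, ‖(n : ℚ_[p])‖ ≤ 1 := fun n => by
    have := Padic.norm_int_le_one (p := p) (n : ℤ)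
    simpa using this
  have hlow : ∀ k : ℕ, 0 < k → 1 ≤ (k : ℝ) * ‖(k : ℚ_[p])‖ := by
    intro k hk
    have hk0 : (k : ℚ_[p]) ≠ 0 := Nat.cast_ne_zero.2 (by omega)
    rw [Padic.norm_eq_zpow_neg_valuation hk0, Padic.valuation_natCast, zpow_neg, zpow_natCast,
      ← div_eq_mul_inv, one_le_div (by have := hp.out.pos; positivity)]
    exact_mod_cast Nat.le_of_dvd hk pow_padicValNat_dvd
  have hterm : ∀ k ∈ Finset.range e, ‖t ^ (k + 2) * ((e + 1).choose (k + 2) : ℚ_[p])‖ <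
      ‖((e + 1 : ℕ) : ℚ_[p])‖ * ‖t‖ := by
    intro k hk
    clear hk
    have h1 : ((e + 1 : ℕ) : ℚ_[p]) * (e.choose (k + 1) : ℚ_[p]) =
        ((e + 1).choose (k + 2) : ℚ_[p]) * ((k + 2 : ℕ) : ℚ_[p]) := by
      exact_mod_cast Nat.add_one_mul_choose_eq e (k + 1)
    have h2 := congrArg norm h1
    rw [norm_mul, norm_mul] at h2
    have h3 := hlow (k + 2) (by omega)
    have h4 := hnat (e.choose (k + 1))
    have h5 : ((k + 2 : ℕ) : ℝ) < 3 ^ (k + 1) := by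
      have : k + 2 < 3 ^ (k + 1) := by
        clear h1 h2 h3 h4
        induction k with
        | zero => norm_num
        | succ k ih => 
          rw [pow_succ]; omega
      exact_mod_cast this
    have h6 : (3 : ℝ) ^ (k + 1) * ‖t‖ ^ (k + 1) ≤ 1 := by
      rw [← mul_pow]; exact pow_le_one₀ (by positivity) ht
    rw [norm_mul, norm_pow]
    set A := ‖((e + 1).choose (k + 2) : ℚ_[p])‖
    set B := ‖((k + 2 : ℕ) : ℚ_[p])‖
    set D := ‖((e + 1 : ℕ) : ℚ_[p])‖
    have hA : 0 ≤ A := norm_nonneg _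
    have hB : 0 < B := by
      by_contra h
      have : B ≤ 0 := not_lt.1 h
      have : ((k + 2 : ℕ) : ℝ) * B ≤ 0 := mul_nonpos_of_nonneg_of_nonpos (by positivity) this
      linarith
    have h7 : A * B ≤ D := by rw [← h2]; exact mul_le_of_le_one_right hdp.le h4
    have h8 : ‖t‖ ^ (k + 1) < B := by
      have : ‖t‖ ^ (k + 1) * ((k + 2 : ℕ) : ℝ) < B * ((k + 2 : ℕ) : ℝ) := by
        calc ‖t‖ ^ (k + 1) * ((k + 2 : ℕ) : ℝ) < ‖t‖ ^ (k + 1) * 3 ^ (k + 1) := by gcongr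
          _ ≤ 1 := by linarith
          _ ≤ _ := by linarith
      exact lt_of_mul_lt_mul_right this (by positivity)
    rcases hA.eq_or_lt with hA0 | hA0
    · rw [← hA0, mul_zero]; positivity
    · calc ‖t‖ ^ (k + 2) * A = (‖t‖ ^ (k + 1) * A) * ‖t‖ := by ring
        _ < (B * A) * ‖t‖ := by gcongr
        _ ≤ D * ‖t‖ := by gcongr; linarith
  have hexp : (1 + t) ^ (e + 1) - 1 = ((e + 1 : ℕ) : ℚ_[p]) * t +
      ∑ k ∈ Finset.range e, t ^ (k + 2) * ((e + 1).choose (k + 2) : ℚ_[p]) := by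
    rw [add_comm 1 t, add_pow, Finset.sum_range_succ', Finset.sum_range_succ']
    simp
    ring
  have hsum : ‖∑ k ∈ Finset.range e, t ^ (k + 2) * ((e + 1).choose (k + 2) : ℚ_[p])‖ <
      ‖((e + 1 : ℕ) : ℚ_[p]) * t‖ := by
    rw [norm_mul]
    refine Finset.sum_induction (fun k => t ^ (k + 2) * ((e + 1).choose (k + 2) : ℚ_[p]))
      (fun z => ‖z‖ < ‖((e + 1 : ℕ) : ℚ_[p])‖ * ‖t‖) ?_ ?_ hterm
    · intro a b ha hb
      exact (Padic.nonarchimedean a b).trans_lt (max_lt ha hb)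
    · simp only [norm_zero]; positivity
  rw [hexp, Padic.add_eq_max_of_ne hsum.ne', max_eq_left hsum.le, norm_mul]

lemma padic_deriv1 (p : ℕ) [hp : Fact p.Prime] (d : ℕ) (hd : 1 ≤ d) (x y : ℚ_[p]) (hy : y ≠ 0)
    (h : 3 * ‖x - y‖ ≤ ‖y‖) : ‖x - y‖ * ‖(d : ℚ_[p])‖ * ‖y‖ ^ (d - 1) ≤ ‖x ^ d - y ^ d‖ := by
  have hy' : 0 < ‖y‖ := norm_pos_iff.2 hy
  have h1 := padic_deriv0 p d ((x - y) / y) (by rw [norm_div, ← mul_div_assoc, div_le_one hy']; exact h)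
  have h2 : x ^ d - y ^ d = y ^ d * ((1 + (x - y) / y) ^ d - 1) := by
    have : 1 + (x - y) / y = x / y := by field_simp; ring
    rw [this, div_pow]; field_simp
  rw [h2, norm_mul, norm_pow]
  have h3 : ‖y‖ ^ d = ‖y‖ ^ (d - 1) * ‖y‖ := by rw [← pow_succ]; congr 1; omega
  calc _ = ‖y‖ ^ d * (‖(d : ℚ_[p])‖ * ‖(x - y) / y‖) := by
        rw [h3, norm_div]; field_simp
    _ ≤ _ := by gcongr

lemma padic_class_aux (p : ℕ) [hp : Fact p.Prime] (d : ℕ) (hd : 2 ≤ d) (n : ℤ) (e : ℕ)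
    (he : 3 ≤ p ^ e) (W : Finset (ZMod (p ^ e))) (hW : W.card ≤ d) (good : ℚ_[p] → Prop)
    (hn : ∀ z, good z → ‖z‖ = (p : ℝ) ^ n)
    (hgood : ∀ z, good z → ∀ u : ℤ_[p], (u : ℚ_[p]) = z * (p : ℚ_[p]) ^ n →
      PadicInt.toZModPow e u ∈ W) :
    ∃ cl : ℚ_[p] → Fin d, ∀ x y, good x → good y → cl x = cl y → 3 * ‖x - y‖ ≤ ‖y‖ := by
  classical
  have hp0 : (0 : ℝ) < p := by exact_mod_cast hp.out.pos
  have hnorm : ∀ z, good z → ‖z * (p : ℚ_[p]) ^ n‖ = 1 := by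
    intro z hz
    rw [norm_mul, hn z hz, Padic.norm_p_zpow, ← zpow_add₀ hp0.ne']; simp
  let r : ℚ_[p] → ZMod (p ^ e) := fun z =>
    if h : ∃ u : ℤ_[p], (u : ℚ_[p]) = z * (p : ℚ_[p]) ^ n then
      PadicInt.toZModPow e h.choose else 0
  have hr0 : ∀ z, good z → ∃ u : ℤ_[p], (u : ℚ_[p]) = z * (p : ℚ_[p]) ^ n ∧
      r z = PadicInt.toZModPow e u := by
    intro z hz
    have h : ∃ u : ℤ_[p], (u : ℚ_[p]) = z * (p : ℚ_[p]) ^ n := ⟨⟨_, (hnorm z hz).le⟩, rfl⟩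
    exact ⟨h.choose, h.choose_spec, dif_pos h⟩
  obtain ⟨g, hg⟩ : ∃ g : ZMod (p ^ e) → Fin d, Set.InjOn g W := by
    have : Nonempty (W ↪ Fin d) := by
      apply Function.Embedding.nonempty_of_card_le; simpa using hW
    obtain ⟨ι⟩ := this
    refine ⟨fun w => if h : w ∈ W then ι ⟨w, h⟩ else ⟨0, by omega⟩, ?_⟩
    intro a ha b hb hab
    have ha' : a ∈ W := ha
    have hb' : b ∈ W := hb
    simp only [ha', hb', dif_pos] at hab
    simpa using ι.injective hab
  refine ⟨fun z => g (r z), fun x y hx hy hxy => ?_⟩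
  obtain ⟨u, hu, hrx⟩ := hr0 x hx
  obtain ⟨v, hv, hry⟩ := hr0 y hy
  have hr : r x = r y := hg (by rw [hrx]; exact hgood x hx u hu) (by rw [hry]; exact hgood y hy v hv) hxy
  rw [hrx, hry, ← sub_eq_zero, ← map_sub, ← RingHom.mem_ker, PadicInt.ker_toZModPow,
    ← PadicInt.norm_le_pow_iff_mem_span_pow, PadicInt.norm_def] at hr
  rw [PadicInt.coe_sub, hu, hv, ← sub_mul, norm_mul, Padic.norm_p_zpow] at hr
  rw [hn y hy]
  have h3 : (3 : ℝ) ≤ (p : ℝ) ^ e := by exact_mod_cast he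
  rw [zpow_neg, zpow_neg, ← div_eq_mul_inv, div_le_iff₀ (by positivity), zpow_natCast] at hr
  calc 3 * ‖x - y‖ ≤ 3 * (((p : ℝ) ^ e)⁻¹ * (p : ℝ) ^ n) := by gcongr
    _ ≤ (p : ℝ) ^ e * (((p : ℝ) ^ e)⁻¹ * (p : ℝ) ^ n) := by gcongr
    _ = _ := by field_simp

lemma padic_class (p : ℕ) [hp : Fact p.Prime] (d : ℕ) (hd : 2 ≤ d) (n : ℤ) (hn1 : 1 ≤ n) (c : ℚ_[p])
    (hc : ‖c‖ = ((p : ℝ) ^ n) ^ d) :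
    ∃ cl : ℚ_[p] → Fin d, ∀ x y, (‖x‖ = (p : ℝ) ^ n ∧ ‖x ^ d + c‖ ≤ (p : ℝ) ^ n) →
      (‖y‖ = (p : ℝ) ^ n ∧ ‖y ^ d + c‖ ≤ (p : ℝ) ^ n) → cl x = cl y → 3 * ‖x - y‖ ≤ ‖y‖ := by
  have hp0 : (0 : ℝ) < p := by exact_mod_cast hp.out.pos
  have hp1 : (1 : ℝ) < p := by exact_mod_cast hp.out.one_lt
  have hT1 : (p : ℝ) ≤ (p : ℝ) ^ n := by
    calc (p : ℝ) = (p : ℝ) ^ (1 : ℤ) := by simp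
      _ ≤ _ := zpow_le_zpow_right₀ hp1.le hn1
  by_cases h2 : p = 2
  · subst h2
    refine padic_class_aux 2 d hd n 2 (by norm_num) ({1, 3} : Finset (ZMod 4)) (by
      refine le_trans ?_ hd; decide)
      (fun z => ‖z‖ = ((2 : ℕ) : ℝ) ^ n ∧ ‖z ^ d + c‖ ≤ ((2 : ℕ) : ℝ) ^ n) (fun z hz => hz.1) ?_
    intro z hz u h
    have hu : IsUnit u := by
      rw [PadicInt.isUnit_iff, PadicInt.norm_def, h, norm_mul, hz.1, Padic.norm_p_zpow, ← zpow_add₀ hp0.ne']; simp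
    have hu2 := hu.map (PadicInt.toZModPow (p := 2) 2)
    have key : ∀ w : ZMod 4, IsUnit w → w ∈ ({1, 3} : Finset (ZMod 4)) := by
      intro w ⟨u, hu⟩
      subst hu
      revert u
      decide
    exact key _ hu2
  · have hp3 : 3 ≤ p ^ 1 := by
      have := hp.out.two_le
      rw [pow_one]; omega
    have : Fact (p ^ 1).Prime := ⟨by simpa using hp.out⟩
    have hcn : ‖c * ((p : ℚ_[p]) ^ n) ^ d‖ ≤ 1 := by
      rw [norm_mul, norm_pow, hc, Padic.norm_p_zpow, ← mul_pow, ← zpow_add₀ hp0.ne']; simp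
    obtain ⟨c', hc'⟩ : ∃ c' : ℤ_[p], (c' : ℚ_[p]) = c * ((p : ℚ_[p]) ^ n) ^ d := ⟨⟨_, hcn⟩, rfl⟩
    refine padic_class_aux p d hd n 1 hp3
      (Polynomial.nthRoots d (-(PadicInt.toZModPow 1
        c'))).toFinset
      ((Multiset.toFinset_card_le _).trans (Polynomial.card_nthRoots _ _))
      (fun z => ‖z‖ = (p : ℝ) ^ n ∧ ‖z ^ d + c‖ ≤ (p : ℝ) ^ n) (fun z hz => hz.1) ?_
    intro z hz u h
    rw [Multiset.mem_toFinset, Polynomial.mem_nthRoots (by omega), eq_neg_iff_add_eq_zero,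
      ← map_pow, ← map_add, ← RingHom.mem_ker, PadicInt.ker_toZModPow,
      ← PadicInt.norm_le_pow_iff_mem_span_pow, PadicInt.norm_def, PadicInt.coe_add,
      PadicInt.coe_pow, h, hc']
    rw [mul_pow, ← add_mul, norm_mul, norm_pow, Padic.norm_p_zpow, zpow_neg]
    simp only [Nat.cast_one, zpow_neg, zpow_one]
    set T := (p : ℝ) ^ n
    have hT0 : 0 < T := by positivity
    rw [inv_pow, ← div_eq_mul_inv, div_le_iff₀ (by positivity)]
    have h5 : T * T ≤ T ^ d := by
      rw [← sq]; exact pow_le_pow_right₀ (by linarith) hd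
    refine hz.2.trans ?_
    rw [← div_eq_inv_mul, le_div_iff₀ hp0]
    nlinarith

lemma padic_local (p : ℕ) [hp : Fact p.Prime] (d : ℕ) (hd : 2 ≤ d) (c : ℚ) (m : ℕ)
    (hm : m = if d = 2 then 2 else 1)
    (T : ℝ) (hT : 1 ≤ T) (hTd : T ^ d = max 1 (padicNorm p c : ℝ)) :
    ∃ cl : ℚ → (Fin m → Fin d), ∀ (x y : ℚ) (l n : ℕ), m ≤ n →
      y = (fun z : ℚ => z ^ d + c)^[l] x → x ≠ y →
      ((padicValRat p c < 0 ∧ (d : ℤ) ∣ padicValRat p c) → cl x = cl y) →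
      Real.log (padicNorm p (x - y) : ℝ) + Real.log T ≤ m * (-Real.log (padicNorm p (d : ℚ) : ℝ)) +
        2 * (d : ℝ) ^ m / (d : ℝ) ^ n *
          Real.log (max 1 (padicNorm p ((fun z : ℚ => z ^ d + c)^[n] y) : ℝ)) := by
  set φ : ℚ → ℚ := fun z : ℚ => z ^ d + c with hφ
  have hm1 : 1 ≤ m := by rw [hm]; split_ifs <;> norm_num
  have hφ' : ∀ z : ℚ, ((φ z : ℚ) : ℚ_[p]) = (z : ℚ_[p]) ^ d + c := by intro z; simp [hφ]
  set f : ℚ → ℝ := fun z => ‖(z : ℚ_[p])‖ with hf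
  have hfp : ∀ z, (padicNorm p z : ℝ) = f z := fun z => (Padic.eq_padicNorm z).symm
  simp only [hfp] at hTd ⊢
  have hp0 : (0 : ℝ) < p := by exact_mod_cast hp.out.pos
  have hp1 : (1 : ℝ) < p := by exact_mod_cast hp.out.one_lt
  have hf0 : ∀ z, 0 ≤ f z := fun z => norm_nonneg _
  have hT0 : 0 < T := by linarith
  have hfφ : ∀ z, f z ^ d ≠ f c → f (φ z) = max (f z ^ d) (f c) := by
    intro z hz
    simp only [hf, hφ'] at hz ⊢
    rw [← norm_pow] at hz ⊢
    exact Padic.add_eq_max_of_ne hz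
  have hcT : f c ≤ T ^ d := by rw [hTd]; exact le_max_right _ _
  have hstep : ∀ x, 1 * T < f x → (f x / 1) ^ d ≤ f (φ x) / 1 := by
    intro x hx
    rw [one_mul] at hx
    rw [div_one, div_one]
    have h1 : T ^ d < f x ^ d := pow_lt_pow_left₀ hx hT0.le (by omega)
    rw [hfφ x (by linarith)]
    exact le_max_left _ _
  have hsub' : ∀ x y, f (x - y) ≤ max (f x) (f y) := by
    intro x y
    simp only [hf, Rat.cast_sub]
    rw [sub_eq_add_neg]
    refine (Padic.nonarchimedean _ _).trans ?_
    rw [norm_neg]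
  have hsub : ∀ x y, f (x - y) ≤ 1 * max (f x) (f y) := by
    intro x y; rw [one_mul]; exact hsub' x y
  have hpos : ∀ x y, x ≠ y → 0 < f (x - y) := by
    intro x y hxy
    simp only [hf]
    rw [norm_pos_iff]
    exact_mod_cast sub_ne_zero.2 hxy
  have hfd1 : f (d : ℚ) ≤ 1 := by
    have := Padic.norm_int_le_one (p := p) (d : ℤ)
    simp only [hf, Rat.cast_natCast]
    simpa using this
  have hfd0 : 0 < f (d : ℚ) := by
    simp only [hf]; rw [norm_pos_iff]; simp; omega
  have hC : 0 ≤ m * (-Real.log (f (d : ℚ))) := by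
    have := Real.log_nonpos hfd0.le hfd1
    exact mul_nonneg (by positivity) (by linarith)
  suffices H : ∃ cl : ℚ → (Fin m → Fin d), ∀ x y : ℚ,
      (∀ t ≤ m, f (φ^[t] x) ≤ T ∧ f (φ^[t] y) ≤ T) →
      ((padicValRat p c < 0 ∧ (d : ℤ) ∣ padicValRat p c) → cl x = cl y) →
      f (x - y) * T * f (d : ℚ) ^ m ≤ 1 by
    obtain ⟨cl, hcl⟩ := H
    refine ⟨cl, fun x y l n hmn hy hne hxy => ?_⟩
    by_cases hesc : 1 * T < f (φ^[m] y)
    · have := dyn_escaped d hd φ f 1 T le_rfl hT hstep hsub hpos x y l m n hmn hy hne hesc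
      rw [Real.log_one] at this
      linarith
    · have h1 := dyn_noesc d hd φ f 1 T le_rfl hT hstep x y l m hy hesc
      simp only [one_mul] at h1
      have h2 := hcl x y h1 hxy
      have h3 := hpos x y hne
      have h4 : Real.log (f (x - y)) + Real.log T ≤ m * (-Real.log (f (d : ℚ))) := by
        have := Real.log_nonpos (by positivity) h2
        rw [Real.log_mul (by positivity) (by positivity), Real.log_mul h3.ne' hT0.ne',
          Real.log_pow] at this
        linarith
      have h5 : 0 ≤ 2 * (d : ℝ) ^ m / (d : ℝ) ^ n * Real.log (max 1 (f (φ^[n] y))) :=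
        mul_nonneg (by positivity) (Real.log_nonneg (le_max_left _ _))
      linarith
  have hfdm : f (d : ℚ) ^ m ≤ 1 := pow_le_one₀ hfd0.le hfd1
  by_cases hgood : f c ≤ 1
  · have hT1 : T = 1 := by
      rw [max_eq_left hgood] at hTd
      exact (pow_eq_one_iff_of_nonneg hT0.le (by omega)).1 hTd
    refine ⟨fun _ _ => ⟨0, by omega⟩, fun x y hes _ => ?_⟩
    have e0 := hes 0 (by omega)
    simp only [Function.iterate_zero, id, hT1] at e0
    have h1 : f (x - y) ≤ 1 := (hsub' x y).trans (max_le e0.1 e0.2)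
    rw [hT1, mul_one]
    exact mul_le_one₀ h1 (by positivity) hfdm
  push Not at hgood
  have hTd' : T ^ d = f c := by rw [hTd, max_eq_right hgood.le]
  have hT1 : 1 < T := by
    by_contra h
    have : T = 1 := by linarith
    rw [this, one_pow] at hTd'
    linarith
  have hTlt : T < f c := by
    rw [← hTd']
    exact lt_self_pow₀ hT1 (by omega)
  have hc0 : c ≠ 0 := by
    rintro rfl
    simp [hf] at hgood
    linarith
  have hval : ∀ z : ℚ, z ≠ 0 → f z = (p : ℝ) ^ (-padicValRat p z) := by
    intro z hz
    simp only [hf]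
    rw [Padic.norm_eq_zpow_neg_valuation (by exact_mod_cast hz), Padic.valuation_ratCast]
  have hvc : padicValRat p c < 0 := by
    rw [hval c hc0] at hgood
    have := (one_lt_zpow_iff_right₀ hp1).1 hgood
    omega
  have heq : ∀ z, f (φ z) ≤ T → f z ^ d = f c := by
    intro z hz
    by_contra h
    rw [hfφ z h] at hz
    have := le_max_right (f z ^ d) (f c)
    linarith
  by_cases hdv : (d : ℤ) ∣ padicValRat p c
  swap
  · -- type I
    refine ⟨fun _ _ => ⟨0, by omega⟩, fun x y hes _ => ?_⟩
    exfalso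
    have e1 := (hes 1 hm1).1
    simp only [Function.iterate_succ, Function.iterate_zero, Function.comp, id] at e1
    have h1 := heq x e1
    have hx0 : x ≠ 0 := by
      rintro rfl
      simp only [hf, Rat.cast_zero, norm_zero] at h1
      rw [zero_pow (by omega)] at h1
      simp only [hf] at hgood
      linarith
    rw [hval x hx0, hval c hc0, ← zpow_natCast, ← zpow_mul] at h1
    have h2 := zpow_right_injective₀ hp0 hp1.ne' h1
    exact hdv ⟨padicValRat p x, by linarith⟩
  obtain ⟨k, hk⟩ := hdv
  have hTk : T = (p : ℝ) ^ (-k) := by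
    have : T ^ d = ((p : ℝ) ^ (-k)) ^ d := by
      rw [hTd', hval c hc0, hk, ← zpow_natCast, ← zpow_mul]
      congr 1; ring
    exact (pow_left_inj₀ hT0.le (by positivity) (by omega)).1 this
  have hk1 : 1 ≤ -k := by
    have : (0 : ℤ) < d := by exact_mod_cast (by omega : 0 < d)
    nlinarith
  obtain ⟨cl, hcl⟩ := padic_class p d hd (-k) hk1 (c : ℚ_[p]) (by rw [← hTk]; exact hTd'.symm)
  have hder : ∀ x y : ℚ, cl x = cl y → f (φ x) ≤ T → f (φ y) ≤ T →
      f (x - y) * f (d : ℚ) * T ^ (d - 1) ≤ f (φ x - φ y) := by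
    intro x y hxy hx hy
    have hxT : f x = T := (pow_left_inj₀ (hf0 x) hT0.le (by omega : d ≠ 0)).1 ((heq x hx).trans hTd'.symm)
    have hyT : f y = T := (pow_left_inj₀ (hf0 y) hT0.le (by omega : d ≠ 0)).1 ((heq y hy).trans hTd'.symm)
    have h1 := hcl x y ⟨by rw [← hTk]; exact hxT, by rw [← hTk, ← hφ']; exact hx⟩
      ⟨by rw [← hTk]; exact hyT, by rw [← hTk, ← hφ']; exact hy⟩ hxy
    have hy0 : (y : ℚ_[p]) ≠ 0 := by
      rw [← norm_pos_iff]; simp only [hf] at hyT; linarith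
    have h2 := padic_deriv1 p d (by omega) (x : ℚ_[p]) y hy0 h1
    simp only [hf, Rat.cast_sub, hφ', Rat.cast_natCast] at hyT ⊢
    rw [hyT] at h2
    convert h2 using 2
    ring
  refine ⟨fun z t => cl ((φ^[t] z : ℚ) : ℚ_[p]), fun x y hes hxy => ?_⟩
  have hxy := hxy ⟨hvc, ⟨k, hk⟩⟩
  have hxy' : ∀ t, t < m → cl ((φ^[t] x : ℚ) : ℚ_[p]) = cl ((φ^[t] y : ℚ) : ℚ_[p]) :=
    fun t ht => congrFun hxy ⟨t, ht⟩
  have c0 := hxy' 0 (by omega)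
  have e1 := hes 1 (by omega)
  simp only [Function.iterate_succ, Function.iterate_zero, Function.comp, id] at c0 e1
  have d1 := hder x y c0 e1.1 e1.2
  by_cases hd2 : d = 2
  · have hm2 : m = 2 := by rw [hm, if_pos hd2]
    have c1 := hxy' 1 (by omega)
    have e2 := hes 2 (by omega)
    simp only [Function.iterate_succ, Function.iterate_zero, Function.comp, id] at c1 e2
    have d2 := hder _ _ c1 e2.1 e2.2
    have h3 : f (φ (φ x) - φ (φ y)) ≤ T := (hsub' _ _).trans (max_le e2.1 e2.2)
    rw [show d - 1 = 1 by omega, pow_one] at d1 d2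
    rw [hm2]
    have h4 : f (φ x - φ y) * f (d : ℚ) ≤ 1 := by
      have : f (φ x - φ y) * f (d : ℚ) * T ≤ 1 * T := by linarith
      exact le_of_mul_le_mul_right this hT0
    calc _ = (f (x - y) * f (d : ℚ) * T) * f (d : ℚ) := by ring
      _ ≤ f (φ x - φ y) * f (d : ℚ) := by gcongr
      _ ≤ 1 := h4
  · have hm2 : m = 1 := by rw [hm, if_neg hd2]
    have h3 : f (φ x - φ y) ≤ T := (hsub' _ _).trans (max_le e1.1 e1.2)
    rw [hm2, pow_one]
    have h4 : T * T ≤ T ^ (d - 1) := by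
      rw [← sq]; exact pow_le_pow_right₀ hT (by omega)
    have h0 := hf0 (x - y)
    have h5 : (f (x - y) * T * f (d : ℚ)) * T ≤ 1 * T := by
      calc _ = f (x - y) * f (d : ℚ) * (T * T) := by ring
        _ ≤ f (x - y) * f (d : ℚ) * T ^ (d - 1) := by gcongr
        _ ≤ _ := by linarith
    exact le_of_mul_le_mul_right h5 hT0

lemma log_nat_sum (n : ℕ) (S : Finset ℕ) (hS : n.primeFactors ⊆ S) (hp : ∀ p ∈ S, p.Prime) :
    Real.log n = ∑ p ∈ S, (padicValNat p n : ℝ) * Real.log p := by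
  rw [Real.log_nat_eq_sum_factorization, Finsupp.sum, Nat.support_factorization,
    Finset.sum_subset hS]
  · refine Finset.sum_congr rfl fun p hpS => ?_
    rw [Nat.factorization_def n (hp p hpS)]
  · intro p _ h
    rw [← Nat.support_factorization, Finsupp.notMem_support_iff] at h
    simp [h]

lemma log_padicNorm (p : ℕ) (hp : p.Prime) (q : ℚ) (hq : q ≠ 0) :
    Real.log (padicNorm p q : ℝ) =
      (padicValNat p q.den : ℝ) * Real.log p - (padicValNat p q.num.natAbs : ℝ) * Real.log p := by
  rw [padicNorm.eq_zpow_of_nonzero hq]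
  push_cast
  rw [Real.log_zpow]
  have h : padicValRat p q = (padicValNat p q.num.natAbs : ℤ) - (padicValNat p q.den : ℤ) := rfl
  rw [h, Int.cast_neg, Int.cast_sub, Int.cast_natCast, Int.cast_natCast]
  ring

lemma log_max_padicNorm (p : ℕ) (hp : p.Prime) (q : ℚ) :
    Real.log (max 1 (padicNorm p q : ℝ)) = (padicValNat p q.den : ℝ) * Real.log p := by
  have : Fact p.Prime := ⟨hp⟩
  have hlp : 0 < Real.log p := Real.log_pos (by exact_mod_cast hp.one_lt)
  by_cases hq : q = 0
  · subst hq; simp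
  have hpos : (0 : ℝ) < (padicNorm p q : ℝ) := by
    have := padicNorm.nonneg (p := p) q
    have h2 := padicNorm.nonzero (p := p) hq
    exact_mod_cast lt_of_le_of_ne this h2.symm
  have h := log_padicNorm p hp q hq
  by_cases hd : p ∣ q.den
  · have hn : ¬ p ∣ q.num.natAbs := fun h' => by
      have := Nat.dvd_gcd h' hd
      rw [q.reduced] at this
      exact hp.one_lt.ne' (Nat.dvd_one.1 this)
    rw [padicValNat.eq_zero_of_not_dvd hn] at h
    rw [max_eq_right, h]
    · simp
    · rw [← Real.log_nonneg_iff hpos, h]; simp; positivity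
  · rw [padicValNat.eq_zero_of_not_dvd hd] at h ⊢
    rw [max_eq_left]
    · simp
    · rw [← Real.log_nonpos_iff hpos.le, h]; simp; positivity

lemma height_eq (q : ℚ) : Real.log (max (|q.num| : ℝ) (q.den : ℝ)) =
    Real.log (max 1 |(q : ℝ)|) + Real.log q.den := by
  have hd : (0 : ℝ) < q.den := by exact_mod_cast q.den_pos
  rw [← Real.log_mul (by positivity) hd.ne', max_mul_of_nonneg _ _ hd.le, one_mul, max_comm]
  congr 2
  conv_rhs => rw [Rat.cast_def, abs_div, abs_of_pos hd]
  field_simp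

lemma log_abs_rat (q : ℚ) (hq : q ≠ 0) :
    Real.log |(q : ℝ)| = Real.log (q.num.natAbs : ℝ) - Real.log (q.den : ℝ) := by
  have hd : (q.den : ℝ) ≠ 0 := by exact_mod_cast q.den_nz
  have hn : (q.num : ℝ) ≠ 0 := by exact_mod_cast Rat.num_ne_zero.2 hq
  conv_lhs => rw [Rat.cast_def, abs_div, Real.log_div (abs_ne_zero.2 hn) (abs_ne_zero.2 hd)]
  rw [Real.log_abs, Real.log_abs, Nat.cast_natAbs, Int.cast_abs, Real.log_abs]

/-- Combining all local estimates. -/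
lemma global_ineq (d : ℕ) (hd : 2 ≤ d) (c a X : ℚ) (ha : a ≠ 0) (m : ℕ) (B : ℝ)
    (harch : Real.log |(a : ℝ)| + (1 / (d : ℝ)) * Real.log (max 1 |(c : ℝ)|) ≤
      2 * m * Real.log 2 + B * Real.log (max 1 |(X : ℝ)|))
    (hfin : ∀ p : ℕ, p.Prime → Real.log (padicNorm p a : ℝ) +
      (1 / (d : ℝ)) * Real.log (max 1 (padicNorm p c : ℝ)) ≤
      m * (-Real.log (padicNorm p (d : ℚ) : ℝ)) + B * Real.log (max 1 (padicNorm p X : ℝ))) :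
    (1 / (d : ℝ)) * ratHeight c ≤ 2 * m * Real.log 2 + m * Real.log d + B * ratHeight X := by
  classical
  set S : Finset ℕ := a.num.natAbs.primeFactors ∪ a.den.primeFactors ∪ c.den.primeFactors ∪
    X.den.primeFactors ∪ d.primeFactors with hS
  have hSp : ∀ p ∈ S, p.Prime := by
    intro p hp
    simp only [hS, Finset.mem_union, Nat.mem_primeFactors] at hp
    tauto
  have s1 := log_nat_sum a.num.natAbs S (by intro p hp; simp only [hS, Finset.mem_union]; tauto) hSp
  have s2 := log_nat_sum a.den S (by intro p hp; simp only [hS, Finset.mem_union]; tauto) hSp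
  have s3 := log_nat_sum c.den S (by intro p hp; simp only [hS, Finset.mem_union]; tauto) hSp
  have s4 := log_nat_sum X.den S (by intro p hp; simp only [hS, Finset.mem_union]; tauto) hSp
  have s5 := log_nat_sum d S (by intro p hp; simp only [hS, Finset.mem_union]; tauto) hSp
  have hsum := Finset.sum_le_sum (fun p hp => hfin p (hSp p hp))
  have hd0 : (d : ℚ) ≠ 0 := by exact_mod_cast (by omega : d ≠ 0)
  have e1 : ∑ p ∈ S, (Real.log (padicNorm p a : ℝ) +
      (1 / (d : ℝ)) * Real.log (max 1 (padicNorm p c : ℝ))) =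
      (Real.log a.den - Real.log (a.num.natAbs : ℝ)) + (1 / (d : ℝ)) * Real.log c.den := by
    rw [s1, s2, s3, Finset.mul_sum, ← Finset.sum_sub_distrib, ← Finset.sum_add_distrib]
    refine Finset.sum_congr rfl fun p hp => ?_
    rw [log_padicNorm p (hSp p hp) a ha, log_max_padicNorm p (hSp p hp)]
  have e2 : ∑ p ∈ S, (m * (-Real.log (padicNorm p (d : ℚ) : ℝ)) +
      B * Real.log (max 1 (padicNorm p X : ℝ))) = m * Real.log d + B * Real.log X.den := by
    rw [s5, s4, Finset.mul_sum, Finset.mul_sum, ← Finset.sum_add_distrib]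
    refine Finset.sum_congr rfl fun p hp => ?_
    rw [log_padicNorm p (hSp p hp) d hd0, log_max_padicNorm p (hSp p hp)]
    simp
  rw [e1, e2] at hsum
  rw [log_abs_rat a ha] at harch
  unfold ratHeight
  rw [height_eq, height_eq]
  linarith

lemma exists_root (d : ℕ) (hd : 2 ≤ d) (M : ℝ) (hM : 1 ≤ M) :
    ∃ T : ℝ, 1 ≤ T ∧ T ^ d = M ∧ Real.log T = (1 / (d : ℝ)) * Real.log M := by
  refine ⟨M ^ (1 / (d : ℝ)), Real.one_le_rpow hM (by positivity), ?_, Real.log_rpow (by linarith) _⟩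
  rw [one_div, Real.rpow_inv_natCast_pow (by linarith) (by omega)]

lemma count_bound (D s N : ℕ) (hD : 3 ≤ D) (hN : N = 2 * ((D + 1) ^ (s + 2) - 1) / D) :
    4 * D ^ s + 1 < N := by
  have hE : 1 ≤ (D + 1) ^ s := Nat.one_le_pow _ _ (by omega)
  have hDE : D ^ s ≤ (D + 1) ^ s := Nat.pow_le_pow_left (by omega) s
  have h1 : 2 * (D + 1) ^ s * (D + 1) + 2 ≤ N := by
    rw [hN, Nat.le_div_iff_mul_le (by omega), pow_add]
    set E := (D + 1) ^ s
    have : 1 ≤ E * (D + 1) ^ 2 := Nat.one_le_iff_ne_zero.2 (by positivity)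
    zify [this]
    have hE' : (1 : ℤ) ≤ E := by exact_mod_cast hE
    nlinarith
  nlinarith

lemma typeII_finite (d : ℕ) (c : ℚ) :
    {p : ℕ | p.Prime ∧ padicValRat p c < 0 ∧ (d : ℤ) ∣ padicValRat p c}.Finite := by
  refine Set.Finite.subset (c.den.primeFactors.finite_toSet) ?_
  rintro p ⟨hp, hv, _⟩
  have h : padicValRat p c = (padicValNat p c.num.natAbs : ℤ) - (padicValNat p c.den : ℤ) := rfl
  rw [Finset.mem_coe, Nat.mem_primeFactors]
  refine ⟨hp, ?_, c.den_nz⟩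
  by_contra hnd
  rw [padicValNat.eq_zero_of_not_dvd hnd] at h
  omega

lemma ratHeight_nonneg (q : ℚ) : 0 ≤ ratHeight q := by
  unfold ratHeight
  apply Real.log_nonneg
  refine le_max_of_le_right ?_
  exact_mod_cast q.den_pos

theorem main_technical_theorem (d : ℕ) (hd : 2 ≤ d) (c : ℚ) (s : ℕ)
    (hs : {p : ℕ | p.Prime ∧ padicValRat p c < 0 ∧ (d : ℤ) ∣ padicValRat p c}.ncard = s)
    (m : ℕ) (hm : m = if d = 2 then 2 else 1)
    (N : ℕ) (hN : N = 2 * ((d ^ m + 1) ^ (s + 2) - 1) / d ^ m)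
    (α : ℚ) :
    (∃ i j : ℕ, i < j ∧ j < N ∧
        (fun z : ℚ => z ^ d + c)^[i] α = (fun z : ℚ => z ^ d + c)^[j] α) ∨
    ∀ L : ℝ,
      Tendsto (fun k : ℕ => ratHeight ((fun z : ℚ => z ^ d + c)^[k] α) / (d : ℝ) ^ k)
        atTop (nhds L) →
      (1 / (d : ℝ) ^ (N + 2)) * (ratHeight c - d * (d + 2 * m) * Real.log 2) ≤ L := by
  classical
  rw [or_iff_not_imp_left]
  intro hprep L hL
  set φ : ℚ → ℚ := fun z : ℚ => z ^ d + c with hφ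
  have hm2 : m ≤ 2 := by rw [hm]; split_ifs <;> norm_num
  have hl2 : 0 < Real.log 2 := Real.log_pos (by norm_num)
  have hD : 3 ≤ d ^ m := by
    rw [hm]; split_ifs with h
    · rw [h]; norm_num
    · rw [pow_one]; omega
  have hcount := count_bound (d ^ m) s N hD hN
  have hlogd : m * Real.log d ≤ d * Real.log 2 := by
    by_cases h : d = 2
    · rw [hm, if_pos h, h]; norm_num
    · rw [hm, if_neg h, Nat.cast_one, one_mul, ← Real.log_pow]
      apply Real.log_le_log (by positivity)
      exact_mod_cast Nat.lt_two_pow_self.le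
  -- local data
  obtain ⟨T0, hT0, hT0d, hT0l⟩ := exists_root d hd (max 1 |(c : ℝ)|) (le_max_left _ _)
  obtain ⟨cl0, hcl0⟩ := arch_local d hd c m hm T0 hT0 hT0d
  have hloc : ∀ p : ℕ, ∃ cl : ℚ → (Fin m → Fin d), p.Prime → ∀ (x y : ℚ) (l n : ℕ), m ≤ n →
      y = φ^[l] x → x ≠ y →
      ((padicValRat p c < 0 ∧ (d : ℤ) ∣ padicValRat p c) → cl x = cl y) →
      Real.log (padicNorm p (x - y) : ℝ) + (1 / (d : ℝ)) * Real.log (max 1 (padicNorm p c : ℝ)) ≤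
        m * (-Real.log (padicNorm p (d : ℚ) : ℝ)) +
        2 * (d : ℝ) ^ m / (d : ℝ) ^ n * Real.log (max 1 (padicNorm p (φ^[n] y) : ℝ)) := by
    intro p
    by_cases hp : p.Prime
    · have : Fact p.Prime := ⟨hp⟩
      obtain ⟨T, hT, hTd, hTl⟩ := exists_root d hd (max 1 (padicNorm p c : ℝ)) (le_max_left _ _)
      obtain ⟨cl, hcl⟩ := padic_local p d hd c m hm T hT hTd
      rw [hTl] at hcl
      exact ⟨cl, fun _ => hcl⟩
    · exact ⟨fun _ _ => ⟨0, by omega⟩, fun h => absurd h hp⟩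
  choose cl hcl using hloc
  -- pigeonhole
  set S2 : Set ℕ := {p : ℕ | p.Prime ∧ padicValRat p c < 0 ∧ (d : ℤ) ∣ padicValRat p c} with hS2
  have hfin : S2.Finite := typeII_finite d c
  letI : Fintype S2 := hfin.fintype
  have hcard : Fintype.card S2 = s := by
    rw [← hs, ← Nat.card_coe_set_eq, Nat.card_eq_fintype_card]
  let F : Fin (N - 1) → Fin 4 × (S2 → Fin m → Fin d) := fun i =>
    (cl0 (φ^[i] α), fun p => cl p (φ^[i] α))
  obtain ⟨i', j', hij', hF'⟩ := Fintype.exists_ne_map_eq_of_card_lt F (by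
    simp only [Fintype.card_prod, Fintype.card_fin, Fintype.card_pi, Finset.prod_const,
      Finset.card_univ, hcard]
    omega)
  obtain ⟨i, j, hij, hF⟩ : ∃ i j : Fin (N - 1), i < j ∧ F i = F j := by
    rcases lt_or_gt_of_ne hij' with h | h
    · exact ⟨i', j', h, hF'⟩
    · exact ⟨j', i', h, hF'.symm⟩
  have hjN := j.2
  have hij2 : (i : ℕ) < j := hij
  have hne : φ^[i] α ≠ φ^[j] α := fun h => hprep ⟨i, j, hij2, by omega, h⟩
  have hyx : φ^[j] α = φ^[(j : ℕ) - i] (φ^[i] α) := by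
    rw [← Function.iterate_add_apply, Nat.sub_add_cancel hij2.le]
  have hd1 : (1 : ℝ) ≤ d := by exact_mod_cast (by omega : 1 ≤ d)
  have hd2 : (2 : ℝ) ≤ d := by exact_mod_cast hd
  set Y := ratHeight c - d * (d + 2 * m) * Real.log 2 with hY
  refine ge_of_tendsto hL ?_
  filter_upwards [eventually_ge_atTop (N + m)] with k hk
  have hkj : k - j + j = k := by omega
  have hX : φ^[k - j] (φ^[j] α) = φ^[k] α := by
    rw [← Function.iterate_add_apply, hkj]
  have hg := global_ineq d hd c (φ^[i] α - φ^[j] α) (φ^[k] α) (sub_ne_zero.2 hne) m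
    (2 * (d : ℝ) ^ m / (d : ℝ) ^ (k - (j : ℕ)))
    (by
      have := hcl0 _ _ _ (k - j) (by omega) hyx hne (congrArg Prod.fst hF)
      rw [hT0l, hX] at this
      exact this)
    (by
      intro p hp
      have := hcl p hp _ _ _ (k - j) (by omega) hyx hne (fun h =>
        congrFun (congrArg Prod.snd hF) ⟨p, hp, h.1, h.2⟩)
      rw [hX] at this
      exact this)
  set H := ratHeight (φ^[k] α) with hH
  have hH0 : 0 ≤ H := ratHeight_nonneg _
  have hH1 : 0 ≤ H / (d : ℝ) ^ k := by positivity
  by_cases hY0 : Y ≤ 0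
  · refine le_trans ?_ hH1
    exact mul_nonpos_of_nonneg_of_nonpos (by positivity) hY0
  push Not at hY0
  have hB : 2 * (d : ℝ) ^ m / (d : ℝ) ^ (k - (j : ℕ)) * H = 2 * (d : ℝ) ^ (m + j) * (H / (d : ℝ) ^ k) := by
    rw [← hkj, pow_add, pow_add, hkj]; field_simp
  have h1 : (1 / (d : ℝ)) * Y ≤ 2 * (d : ℝ) ^ (m + j) * (H / (d : ℝ) ^ k) := by
    rw [← hB, hY, mul_sub]
    have : (1 / (d : ℝ)) * (d * (d + 2 * m) * Real.log 2) = (d + 2 * m) * Real.log 2 := by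
      field_simp
    rw [this]
    linarith
  have h2 : 2 * (d : ℝ) ^ (m + j) ≤ (d : ℝ) ^ (N + 1) := by
    calc 2 * (d : ℝ) ^ (m + j) ≤ d * (d : ℝ) ^ (m + j) := by gcongr
      _ = (d : ℝ) ^ (m + j + 1) := by ring
      _ ≤ _ := pow_le_pow_right₀ hd1 (by omega)
  have h3 : (1 / (d : ℝ)) * Y ≤ (d : ℝ) ^ (N + 1) * (H / (d : ℝ) ^ k) := h1.trans (by gcongr)
  calc (1 / (d : ℝ) ^ (N + 2)) * Y = (1 / (d : ℝ) ^ (N + 1)) * ((1 / (d : ℝ)) * Y) := by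
        rw [show N + 2 = N + 1 + 1 by omega, pow_succ]; field_simp
    _ ≤ (1 / (d : ℝ) ^ (N + 1)) * ((d : ℝ) ^ (N + 1) * (H / (d : ℝ) ^ k)) := by gcongr
    _ = _ := by field_simp
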